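/- arXiv:1806.11132 — 3 statements merged into one kernel-verified Lean document; each statement's English description precedes it below -/
import Mathlib

section
/- Let G be an FC-group with finitely many automorphism orbits. Then the derived subgroup G' is finite. -/
/-- The number of automorphism orbits of a group `G`: the number of orbits of the
natural action of `Aut(G)` on `G`. -/
noncomputable def omegaOrbits (G : Type*) [Group G] : ℕ :=
  Nat.card (Quotient (MulAction.orbitRel (MulAut G) G))

/-- `G` is an FC-group: every element has a finite conjugacy class. -/
def IsFCGroup (G : Type*) [Group G] : Prop :=
  ∀ g : G, {h : G | IsConj g h}.Finite

/-- `G` has finitely many automorphism orbits. -/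
def HasFinitelyManyAutOrbits (G : Type*) [Group G] : Prop :=
  Finite (Quotient (MulAction.orbitRel (MulAut G) G))

/-- Two elements in the same orbit of `Aut(G)` have conjugacy classes of the same size. -/
theorem ncard_isConj_mulAut_apply {G : Type*} [Group G] (φ : MulAut G) (g : G) :
    {h : G | IsConj (φ g) h}.ncard = {h : G | IsConj g h}.ncard := by
  have himage : {h : G | IsConj (φ g) h} = φ '' {h : G | IsConj g h} := by
    ext h
    constructor
    · intro hh
      obtain ⟨c, rfl⟩ := isConj_iff.mp hh
      refine ⟨φ.symm c * g * (φ.symm c)⁻¹, isConj_iff.mpr ⟨_, rfl⟩, ?_⟩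
      simp
    · rintro ⟨k, hk, rfl⟩
      exact φ.toMonoidHom.map_isConj hk
  rw [himage, Set.ncard_image_of_injective _ φ.injective]

/-- In a group with finitely many automorphism orbits, some conjugacy class has maximal size. -/
theorem HasFinitelyManyAutOrbits.exists_max_ncard_isConj {G : Type*} [Group G]
    (hfin : HasFinitelyManyAutOrbits G) :
    ∃ x : G, ∀ g : G, {h : G | IsConj g h}.ncard ≤ {h : G | IsConj x h}.ncard := by
  have : Finite (Quotient (MulAction.orbitRel (MulAut G) G)) := hfin
  let N : Quotient (MulAction.orbitRel (MulAut G) G) → ℕ :=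
    Quotient.lift (fun g : G => {h : G | IsConj g h}.ncard) (by
      rintro _ b ⟨φ, rfl⟩
      exact ncard_isConj_mulAut_apply φ b)
  have : Nonempty (Quotient (MulAction.orbitRel (MulAut G) G)) := ⟨Quotient.mk _ 1⟩
  obtain ⟨q, hq⟩ := Finite.exists_max N
  induction q using Quotient.inductionOn with
  | h x => exact ⟨x, fun g => hq (Quotient.mk _ g)⟩

/-- In an FC-group, the set of conjugates of the members of a finite set is finite. -/
theorem IsFCGroup.finite_setOf_exists_isConj {G : Type*} [Group G] (hFC : IsFCGroup G)
    {T : Set G} (hT : T.Finite) : {h : G | ∃ t ∈ T, IsConj t h}.Finite := by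
  have hunion : {h : G | ∃ t ∈ T, IsConj t h} = ⋃ t ∈ T, {h : G | IsConj t h} := by
    ext; simp
  rw [hunion]
  exact hT.biUnion fun t _ => hFC t

/-- In an FC-group, the common centralizer of finitely many elements has finite index, in the form:
there is a finite set of elements such that each `g` is `c * s` with `s` in this set and `c`
commuting with all the given elements. -/
theorem IsFCGroup.exists_finite_commute_mul {G ι : Type*} [Group G] [Finite ι]
    (hFC : IsFCGroup G) (t : ι → G) :
    ∃ S : Set G, S.Finite ∧ ∀ g : G, ∃ s ∈ S, ∀ i, Commute (g * s⁻¹) (t i) := by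
  let Φ : G → ι → G := fun g i => g⁻¹ * t i * g
  have hΦ : (Set.range Φ).Finite := by
    refine (Set.Finite.pi' fun i => hFC (t i)).subset ?_
    rintro _ ⟨g, rfl⟩ i
    exact isConj_iff.mpr ⟨g⁻¹, by simp [Φ]⟩
  have : Finite (Set.range Φ) := hΦ
  refine ⟨Set.range (Set.rangeSplitting Φ), Set.finite_range _, fun g =>
    ⟨Set.rangeSplitting Φ ⟨Φ g, g, rfl⟩, ⟨_, rfl⟩, fun i => ?_⟩⟩
  have hs := congrFun (Set.apply_rangeSplitting Φ ⟨Φ g, g, rfl⟩) i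
  generalize Set.rangeSplitting Φ ⟨Φ g, g, rfl⟩ = s at hs
  change s⁻¹ * t i * s = g⁻¹ * t i * g at hs
  calc g * s⁻¹ * t i = g * (s⁻¹ * t i * s) * s⁻¹ := by group
    _ = t i * (g * s⁻¹) := by rw [hs]; group

/-- Suppose `x` has a finite conjugacy class of maximal size, whose members are obtained from `x`
on conjugating by the `t a`. If `c` commutes with all the `t a`, then every conjugate of `c * x`
is `c * a` for some conjugate `a` of `x`. -/
theorem exists_isConj_eq_mul_of_commute {G : Type*} [Group G] (hFC : IsFCGroup G) {x : G}
    (hx : ∀ g : G, {h : G | IsConj g h}.ncard ≤ {h : G | IsConj x h}.ncard)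
    {t : {h : G | IsConj x h} → G} (ht : ∀ a, t a * x * (t a)⁻¹ = a)
    {c : G} (hc : ∀ a, Commute c (t a)) {k : G} (hk : IsConj (c * x) k) :
    ∃ a, IsConj x a ∧ k = c * a := by
  have hsub : (c * ·) '' {h : G | IsConj x h} ⊆ {h : G | IsConj (c * x) h} := by
    rintro _ ⟨a, ha, rfl⟩
    refine isConj_iff.mpr ⟨t ⟨a, ha⟩, ?_⟩
    calc t ⟨a, ha⟩ * (c * x) * (t ⟨a, ha⟩)⁻¹
        = t ⟨a, ha⟩ * c * x * (t ⟨a, ha⟩)⁻¹ := by group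
      _ = c * (t ⟨a, ha⟩ * x * (t ⟨a, ha⟩)⁻¹) := by rw [← (hc ⟨a, ha⟩).eq]; group
      _ = c * a := by rw [ht]
  have heq := Set.eq_of_subset_of_ncard_le hsub
    (by rw [Set.ncard_image_of_injective _ (mul_right_injective c)]; exact hx _) (hFC _)
  obtain ⟨a, ha, rfl⟩ := heq.symm.subset hk
  exact ⟨a, ha, rfl⟩

/-- An FC-group with a conjugacy class of maximal size has only finitely many commutators. -/
theorem IsFCGroup.finite_commutatorSet {G : Type*} [Group G] (hFC : IsFCGroup G) {x : G}
    (hx : ∀ g : G, {h : G | IsConj g h}.ncard ≤ {h : G | IsConj x h}.ncard) :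
    (commutatorSet G).Finite := by
  have hA : {h : G | IsConj x h}.Finite := hFC x
  have : Finite {h : G | IsConj x h} := hA
  choose t ht using fun a : {h : G | IsConj x h} => isConj_iff.mp a.2
  obtain ⟨S, hS, hSG⟩ := hFC.exists_finite_commute_mul t
  have hF := hFC.finite_setOf_exists_isConj
    (hS.image2 (· * ·) (hFC.finite_setOf_exists_isConj (hS.image (·⁻¹))))
  have hK := hFC.finite_setOf_exists_isConj (hA.image2 (fun b a => b * a⁻¹) hA)
  refine (hF.image2 (· * ·) hK).subset ?_
  rintro _ ⟨g, h, rfl⟩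
  obtain ⟨s, hs, hc⟩ := hSG g
  obtain ⟨c, rfl⟩ : ∃ c, g = c * s := ⟨g * s⁻¹, by group⟩
  rw [mul_inv_cancel_right] at hc
  obtain ⟨a, ha, hac⟩ := exists_isConj_eq_mul_of_commute hFC hx ht hc
    (isConj_iff.mpr ⟨h, rfl⟩ : IsConj (c * x) (h * (c * x) * h⁻¹))
  refine ⟨c * (s * (h * s⁻¹ * h⁻¹)) * c⁻¹, ⟨_, Set.mem_image2_of_mem hs
    ⟨_, ⟨s, hs, rfl⟩, isConj_iff.mpr ⟨h, rfl⟩⟩, isConj_iff.mpr ⟨c, rfl⟩⟩,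
    c * (h * x * h⁻¹ * a⁻¹) * c⁻¹, ⟨_, Set.mem_image2_of_mem
    (isConj_iff.mpr ⟨h, rfl⟩) ha, isConj_iff.mpr ⟨c, rfl⟩⟩, ?_⟩
  have ha' : a = c⁻¹ * (h * (c * x) * h⁻¹) := by rw [hac]; group
  rw [ha', commutatorElement_def]
  group

theorem stmt5 (G : Type*) [Group G] (hFC : IsFCGroup G)
    (hfin : HasFinitelyManyAutOrbits G) :
    Finite (commutator G) := by
  obtain ⟨x, hx⟩ := hfin.exists_max_ncard_isConj
  have : Finite (commutatorSet G) := hFC.finite_commutatorSet hx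
  infer_instance
end

section
/- Let G be a non-abelian FC-group with ω(G) ≤ 5. Then G has finite exponent. -/
open Subgroup

/-- If a property of pairs `(x, n)` is invariant under automorphisms in `x`, stable under multiples
in `n`, and holds at every `x` for some positive `n`, then finiteness of the number of automorphism
orbits yields an `n` that works for all `x`. -/
theorem HasFinitelyManyAutOrbits.exists_uniform {G : Type*} [Group G]
    (hfin : HasFinitelyManyAutOrbits G) {P : G → ℕ → Prop}
    (haut : ∀ (α : MulAut G) (x : G) (n : ℕ), P x n → P (α x) n)
    (hdvd : ∀ (x : G) (m n : ℕ), m ∣ n → P x m → P x n)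
    (hex : ∀ x, ∃ n, 0 < n ∧ P x n) :
    ∃ n, 0 < n ∧ ∀ x, P x n := by
  have : Finite (Quotient (MulAction.orbitRel (MulAut G) G)) := hfin
  have := Fintype.ofFinite (Quotient (MulAction.orbitRel (MulAut G) G))
  choose n hn hP using hex
  refine ⟨∏ q : Quotient (MulAction.orbitRel (MulAut G) G), n q.out,
    Finset.prod_pos fun q _ => hn _, fun x => ?_⟩
  obtain ⟨α, hα⟩ : ∃ α : MulAut G,
      α (Quotient.mk (MulAction.orbitRel (MulAut G) G) x).out = x :=
    (MulAction.orbitRel (MulAut G) G).symm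
      (Quotient.mk_out (s := MulAction.orbitRel (MulAut G) G) x)
  refine hdvd x _ _ (Finset.dvd_prod_of_mem (fun q => n (Quotient.out q))
    (Finset.mem_univ (Quotient.mk _ x))) ?_
  have := haut α _ _ (hP (Quotient.mk (MulAction.orbitRel (MulAut G) G) x).out)
  rwa [hα] at this

theorem isOfFinOrder_mulAut_apply_iff {G : Type*} [Group G] (α : MulAut G) {x : G} :
    IsOfFinOrder (α x) ↔ IsOfFinOrder x :=
  Function.Injective.isOfFinOrder_iff (f := α.toMonoidHom) α.injective

theorem mulAut_apply_mem_center {G : Type*} [Group G] (α : MulAut G) {z : G}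
    (hz : z ∈ center G) : α z ∈ center G := by
  refine mem_center_iff.2 fun g => ?_
  simpa using congrArg α (mem_center_iff.1 hz (α⁻¹ g))

theorem IsFCGroup.finiteIndex_centralizer {G : Type*} [Group G] (hFC : IsFCGroup G) (g : G) :
    (centralizer {g}).FiniteIndex := by
  constructor
  have hidx : (centralizer {g}).index = (MulAction.orbit (ConjAct G) g).ncard := by
    rw [centralizer_eq_comap_stabilizer]
    exact (index_comap_of_surjective _ ConjAct.toConjAct.surjective).trans
      (MulAction.index_stabilizer _ _)
  rw [hidx]
  have hfin : (MulAction.orbit (ConjAct G) g).Finite :=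
    (hFC g).subset fun h hh => (ConjAct.mem_orbit_conjAct.1 hh).symm
  exact (Set.ncard_pos hfin).2 ⟨g, MulAction.mem_orbit_self g⟩ |>.ne'

open scoped IsMulCommutative in
/-- **Dietzmann's lemma** for a single element of an FC-group. -/
theorem IsFCGroup.finite_normalClosure {G : Type*} [Group G] (hFC : IsFCGroup G) {t : G}
    (ht : IsOfFinOrder t) : Finite (normalClosure {t}) := by
  obtain ⟨n, hn, htn⟩ := isOfFinOrder_iff_pow_eq_one.1 ht
  have hSfin : (Group.conjugatesOfSet {t}).Finite :=
    (hFC t).subset fun x hx => by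
      obtain ⟨a, rfl, h⟩ := Group.mem_conjugatesOfSet_iff.1 hx
      exact h
  have := hSfin.to_subtype
  have hfg : Group.FG (normalClosure {t}) :=
    Group.closure_finite_fg (Group.conjugatesOfSet {t})
  have hcent : (centralizer (Group.conjugatesOfSet {t})).FiniteIndex := by
    rw [centralizer_eq_iInf, iInf_subtype']
    exact finiteIndex_iInf fun x => hFC.finiteIndex_centralizer _
  have hZ : (center (normalClosure {t})).FiniteIndex := by
    refine finiteIndex_of_le (H := (centralizer (Group.conjugatesOfSet {t})).subgroupOf _) ?_
    intro x hx
    rw [← centralizer_closure, mem_subgroupOf] at hx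
    exact mem_center_iff.2 fun y => Subtype.ext (mem_centralizer_iff.1 hx y y.2)
  have htors : normalClosure {t} ≤ (((powMonoidHom (α := center (normalClosure {t})) n).comp
      (MonoidHom.transferCenterPow (normalClosure {t}))).ker).map (normalClosure {t}).subtype := by
    refine (closure_le _).2 fun x hx => ?_
    refine ⟨⟨x, subset_closure hx⟩, ?_, rfl⟩
    obtain ⟨a, rfl, h⟩ := Group.mem_conjugatesOfSet_iff.1 hx
    obtain ⟨c, rfl⟩ := isConj_iff.1 h
    refine MonoidHom.mem_ker.2 (Subtype.ext (Subtype.ext ?_))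
    simp only [MonoidHom.comp_apply, powMonoidHom_apply, SubmonoidClass.coe_pow,
      MonoidHom.transferCenterPow_apply, OneMemClass.coe_one]
    rw [pow_right_comm, conj_pow, htn]
    simp
  have : Finite (center (normalClosure {t})) := by
    refine CommGroup.finite_of_fg_isMulTorsion _ fun z => ?_
    obtain ⟨y, hy, hyz⟩ := htors z.1.2
    obtain rfl : y = z.1 := Subtype.ext hyz
    have h := congrArg (fun w : center (normalClosure {t}) => (w : normalClosure {t}))
      (MonoidHom.mem_ker.1 hy)
    simp only [MonoidHom.comp_apply, powMonoidHom_apply, SubmonoidClass.coe_pow,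
      MonoidHom.transferCenterPow_apply, OneMemClass.coe_one, ← pow_mul] at h
    exact isOfFinOrder_iff_pow_eq_one.2
      ⟨_, Nat.mul_pos (Nat.pos_of_ne_zero hZ.index_ne_zero) hn, Subtype.ext h⟩
  have := (center (normalClosure {t})).finite_quotient_of_finiteIndex
  exact Finite.of_subgroup_quotient (center (normalClosure {t}))

theorem exists_mem_center_of_prime_dvd_card {G : Type*} [Group G] {p : ℕ} [Fact p.Prime]
    {N : Subgroup G} [N.Normal] [Finite N] (hN : p ∣ Nat.card N)
    (hG : ∀ g : G, g ^ p ∈ center G) : ∃ b ∈ N, b ≠ 1 ∧ b ∈ center G := by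
  have hP : IsPGroup p (MulAut.conjNormal (H := N)).range := by
    rintro ⟨_, g, rfl⟩
    refine ⟨1, Subtype.ext (MulEquiv.ext fun x => Subtype.ext ?_)⟩
    simp only [pow_one, SubmonoidClass.coe_pow, ← map_pow, MulAut.conjNormal_apply,
      OneMemClass.coe_one, MulAut.one_apply]
    rw [← mem_center_iff.1 (hG g), mul_inv_cancel_right]
  obtain ⟨b, hb, hb1⟩ := hP.exists_fixed_point_of_prime_dvd_card_of_fixed_point N hN (a := 1)
    fun g => smul_one g
  refine ⟨b, b.2, fun h => hb1 (Subtype.ext h.symm), mem_center_iff.2 fun g => ?_⟩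
  have := congrArg Subtype.val (hb ⟨_, g, rfl⟩)
  exact mul_inv_eq_iff_eq_mul.1 this

theorem HasFinitelyManyAutOrbits.exists_forall_pow_eq_one {G : Type*} [Group G]
    (hfin : HasFinitelyManyAutOrbits G) :
    ∃ n, 0 < n ∧ ∀ x : G, IsOfFinOrder x → x ^ n = 1 := by
  refine hfin.exists_uniform (P := fun x n => IsOfFinOrder x → x ^ n = 1) ?_ ?_ ?_
  · intro α x n h hx
    rw [← map_pow, h ((isOfFinOrder_mulAut_apply_iff α).1 hx), map_one]
  · rintro x m _ ⟨k, rfl⟩ h hx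
    rw [pow_mul, h hx, one_pow]
  · intro x
    by_cases hx : IsOfFinOrder x
    · obtain ⟨n, hn, h⟩ := isOfFinOrder_iff_pow_eq_one.1 hx
      exact ⟨n, hn, fun _ => h⟩
    · exact ⟨1, one_pos, fun h => (hx h).elim⟩

theorem IsFCGroup.exists_forall_pow_mem_center {G : Type*} [Group G] (hFC : IsFCGroup G)
    (hfin : HasFinitelyManyAutOrbits G) : ∃ n, 0 < n ∧ ∀ g : G, g ^ n ∈ center G := by
  obtain ⟨n, hn, h⟩ := hfin.exists_uniform (P := fun x n => ∀ g : G, Commute x (g ^ n))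
    (fun α x n h g => by simpa using (h (α⁻¹ g)).map α)
    (by
      rintro x m _ ⟨k, rfl⟩ h g
      rw [pow_mul]
      exact (h g).pow_right k)
    (fun x => by
      have := hFC.finiteIndex_centralizer x
      refine ⟨_, Nat.factorial_pos (centralizer {x}).index, fun g => ?_⟩
      exact mem_centralizer_iff.1 (pow_mem_of_index_ne_zero_of_dvd
        (FiniteIndex.index_ne_zero (H := centralizer {x})) g
        fun m hm hle => Nat.dvd_factorial hm hle) x rfl)
  exact ⟨n, hn, fun g => mem_center_iff.2 fun x => h x g⟩

theorem HasFinitelyManyAutOrbits.exists_central_pow_divisible {G : Type*} [Group G]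
    (hfin : HasFinitelyManyAutOrbits G) :
    ∃ k, 0 < k ∧ ∀ z ∈ center G, ∀ m, 0 < m → ∃ w ∈ center G, w ^ m = z ^ k := by
  obtain ⟨k, hk, h⟩ := hfin.exists_uniform
    (P := fun x n => (∃ w ∈ center G, w ^ n = x) → ∀ m, 0 < m → ∃ w ∈ center G, w ^ m = x)
    (by
      rintro α x n h ⟨w, hw, hwx⟩ m hm
      obtain ⟨v, hv, hvx⟩ := h ⟨α⁻¹ w, mulAut_apply_mem_center (α⁻¹) hw, by
        rw [← map_pow, hwx]; simp⟩ m hm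
      exact ⟨α v, mulAut_apply_mem_center α hv, by rw [← map_pow, hvx]⟩)
    (by
      rintro x m _ ⟨k, rfl⟩ h ⟨w, hw, hwx⟩
      exact h ⟨w ^ k, pow_mem hw k, by rw [← pow_mul, mul_comm, hwx]⟩)
    (fun x => by
      by_cases hx : ∀ m, 0 < m → ∃ w ∈ center G, w ^ m = x
      · exact ⟨1, one_pos, fun _ => hx⟩
      · push Not at hx
        obtain ⟨m, hm, h⟩ := hx
        exact ⟨m, hm, fun ⟨w, hw, hwx⟩ => (h w hw hwx).elim⟩)
  exact ⟨k, hk, fun z hz => h _ ⟨z, hz, rfl⟩⟩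

/-- An FC-group with finitely many automorphism orbits is the product of its centre and its
torsion elements. -/
theorem IsFCGroup.exists_eq_central_mul_torsion {G : Type*} [Group G] (hFC : IsFCGroup G)
    (hfin : HasFinitelyManyAutOrbits G) (g : G) :
    ∃ w ∈ center G, ∃ t : G, IsOfFinOrder t ∧ g = w * t := by
  obtain ⟨n, hn, hcen⟩ := hFC.exists_forall_pow_mem_center hfin
  obtain ⟨k, hk, hdiv⟩ := hfin.exists_central_pow_divisible
  obtain ⟨w, hw, hwg⟩ := hdiv _ (hcen g) (n * k) (Nat.mul_pos hn hk)
  refine ⟨w, hw, w⁻¹ * g, isOfFinOrder_iff_pow_eq_one.2 ⟨n * k, Nat.mul_pos hn hk, ?_⟩, by simp⟩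
  have hcomm : Commute w⁻¹ g := (mem_center_iff.1 (inv_mem hw) g).symm
  rw [hcomm.mul_pow, inv_pow, hwg, pow_mul, inv_mul_cancel]

/-- Translating by a suitable central element of infinite order doubles the number of
automorphism orbits of torsion elements. -/
theorem two_mul_card_le_omegaOrbits {G : Type*} [Group G] (hfin : HasFinitelyManyAutOrbits G)
    {z : G} (hz : z ∈ center G) (hzinf : ¬ IsOfFinOrder z) {ι : Type*} [Finite ι] (v : ι → G)
    (hv : ∀ i, IsOfFinOrder (v i))
    (hinj : ∀ i j, (∃ α : MulAut G, α (v j) = v i) → i = j) :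
    2 * Nat.card ι ≤ omegaOrbits G := by
  have : Finite (Quotient (MulAction.orbitRel (MulAut G) G)) := hfin
  obtain ⟨e, he, htor⟩ := hfin.exists_forall_pow_eq_one
  have hzcomm (n : ℕ) (y : G) : Commute (z ^ n) y := (mem_center_iff.1 (pow_mem hz n) y).symm
  have hpow (i : ι) : (z ^ e * v i) ^ e = z ^ (e * e) := by
    rw [(hzcomm e _).mul_pow, htor _ (hv i), mul_one, pow_mul]
  have hninf (i : ι) : ¬ IsOfFinOrder (z ^ e * v i) := fun h => hzinf <| by
    refine isOfFinOrder_iff_pow_eq_one.2 ⟨e * e, Nat.mul_pos he he, ?_⟩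
    rw [← hpow i, htor _ h]
  have hfix (α : MulAut G) (h : α (z ^ (e * e)) = z ^ (e * e)) : α (z ^ e) = z ^ e := by
    have hc : Commute (α z) z⁻¹ := by simpa using ((hzcomm 1 (α z)).symm.inv_right)
    have hfo : IsOfFinOrder (α z * z⁻¹) := by
      refine isOfFinOrder_iff_pow_eq_one.2 ⟨e * e, Nat.mul_pos he he, ?_⟩
      rw [hc.mul_pow, ← map_pow, h, inv_pow, mul_inv_cancel]
    have := htor _ hfo
    rwa [hc.mul_pow, inv_pow, mul_inv_eq_one, ← map_pow] at this
  let u : ι ⊕ ι → G := Sum.elim v fun i => z ^ e * v i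
  have key : Function.Injective
      fun i => Quotient.mk (MulAction.orbitRel (MulAut G) G) (u i) := by
    intro a b hab
    obtain ⟨α, hα⟩ : ∃ α : MulAut G, α (u b) = u a := Quotient.exact hab
    rcases a with i | i <;> rcases b with j | j <;>
      simp only [u, Sum.elim_inl, Sum.elim_inr] at hα
    · rw [hinj i j ⟨α, hα⟩]
    · exact (hninf j ((isOfFinOrder_mulAut_apply_iff α).1 (hα ▸ hv i))).elim
    · exact (hninf i (hα ▸ (isOfFinOrder_mulAut_apply_iff α).2 (hv j))).elim
    · have h := congrArg (· ^ e) hα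
      simp only [← map_pow, hpow] at h
      rw [map_mul, hfix α h, mul_right_inj] at hα
      rw [hinj i j ⟨α, hα⟩]
  have := Nat.card_le_card_of_injective _ key
  rwa [Nat.card_sum, ← two_mul] at this

theorem exists_mulAut_apply_eq_of_omegaOrbits_le_five {G : Type*} [Group G]
    (hfin : HasFinitelyManyAutOrbits G) (h5 : omegaOrbits G ≤ 5)
    {z : G} (hz : z ∈ center G) (hzinf : ¬ IsOfFinOrder z) {s t : G}
    (hs : IsOfFinOrder s) (ht : IsOfFinOrder t) (hs1 : s ≠ 1) (ht1 : t ≠ 1) :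
    ∃ α : MulAut G, α s = t := by
  by_contra hst
  have hts : ¬ ∃ α : MulAut G, α t = s := fun ⟨α, hα⟩ => hst ⟨α⁻¹, by rw [← hα]; simp⟩
  have h6 := two_mul_card_le_omegaOrbits hfin hz hzinf ![1, s, t]
    (by intro i; fin_cases i <;> simp [hs, ht])
    (by
      intro i j h
      fin_cases i <;> fin_cases j <;>
        simp_all [eq_comm (a := (1 : G))])
  rw [Nat.card_fin] at h6
  omega

theorem stmt10 (G : Type*) [Group G] (hFC : IsFCGroup G)
    (hna : ¬ ∀ a b : G, a * b = b * a)
    (hfin : HasFinitelyManyAutOrbits G) (h5 : omegaOrbits G ≤ 5) :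
    ∃ n : ℕ, 0 < n ∧ ∀ g : G, g ^ n = 1 := by
  obtain ⟨e, he, htor⟩ := hfin.exists_forall_pow_eq_one
  by_cases hall : ∀ g : G, IsOfFinOrder g
  · exact ⟨e, he, fun g => htor g (hall g)⟩
  exfalso
  push Not at hall
  obtain ⟨g, hg⟩ := hall
  obtain ⟨n, hn, hcen⟩ := hFC.exists_forall_pow_mem_center hfin
  have hginf : ¬ IsOfFinOrder (g ^ n) := fun h => hg ((isOfFinOrder_pow.1 h).resolve_right hn.ne')
  have horb {s t : G} (hs : IsOfFinOrder s) (ht : IsOfFinOrder t) (hs1 : s ≠ 1) (ht1 : t ≠ 1) :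
      ∃ α : MulAut G, α s = t :=
    exists_mulAut_apply_eq_of_omegaOrbits_le_five hfin h5 (hcen g) hginf hs ht hs1 ht1
  obtain ⟨t, ht, htc⟩ : ∃ t : G, IsOfFinOrder t ∧ t ∉ center G := by
    by_contra! h
    refine hna fun a b => ?_
    obtain ⟨w, hw, t, ht, rfl⟩ := hFC.exists_eq_central_mul_torsion hfin b
    exact mem_center_iff.1 (mul_mem hw (h t ht)) a
  have ht1 : t ≠ 1 := fun h => htc (h ▸ one_mem _)
  obtain ⟨p, hp, hpt⟩ := Nat.exists_prime_and_dvd (mt orderOf_eq_one_iff.1 ht1)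
  have := Fact.mk hp
  have hsord := orderOf_pow_orderOf_div ht.orderOf_pos.ne' hpt
  set s := t ^ (orderOf t / p)
  have hpow (x : G) (hx : IsOfFinOrder x) : x ^ p = 1 := by
    by_cases hx1 : x = 1
    · rw [hx1, one_pow]
    · have hs1 : s ≠ 1 := fun h => hp.one_lt.ne' (by rw [← hsord, h, orderOf_one])
      obtain ⟨α, rfl⟩ := horb (orderOf_pos_iff.1 (hsord ▸ hp.pos)) hx hs1 hx1
      rw [← map_pow, ← hsord, pow_orderOf_eq_one, map_one]
  have hpcen (x : G) : x ^ p ∈ center G := by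
    obtain ⟨w, hw, y, hy, rfl⟩ := hFC.exists_eq_central_mul_torsion hfin x
    have hc : Commute w y := (mem_center_iff.1 hw y).symm
    rw [hc.mul_pow, hpow y hy, mul_one]
    exact pow_mem hw p
  have := hFC.finite_normalClosure ht
  obtain ⟨b, hbN, hb1, hb⟩ := exists_mem_center_of_prime_dvd_card (N := normalClosure {t})
    (hpt.trans ((normalClosure {t}).orderOf_dvd_natCard (subset_normalClosure rfl))) hpcen
  have hbfin : IsOfFinOrder b :=
    Submonoid.isOfFinOrder_coe.2 (isOfFinOrder_of_finite (⟨b, hbN⟩ : normalClosure {t}))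
  obtain ⟨α, rfl⟩ := horb hbfin ht hb1 ht1
  exact htc (mulAut_apply_mem_center α hb)
end

section
/- Let G be an infinite FC-group with ω(G) ≤ 7. Then G is soluble. -/
open scoped Pointwise commutatorElement

section AutomorphismOrbits

variable {G : Type*} [Group G]

/-- A family of pairwise non-automorphic elements is no larger than the number of automorphism
orbits. -/
theorem card_le_omegaOrbits (hG : HasFinitelyManyAutOrbits G) {ι : Type*} (f : ι → G)
    (hf : ∀ i j, ∀ φ : MulAut G, φ (f i) = f j → i = j) : Nat.card ι ≤ omegaOrbits G := by
  have : Finite (Quotient (MulAction.orbitRel (MulAut G) G)) := hG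
  refine Nat.card_le_card_of_injective
    (fun i => (Quotient.mk (MulAction.orbitRel (MulAut G) G) (f i))) fun i j hij => ?_
  obtain ⟨φ, hφ⟩ := Quotient.exact hij
  exact (hf j i φ hφ).symm

end AutomorphismOrbits

section FCGroup

variable {G : Type*} [Group G]

theorem finiteIndex_centralizer_singleton (hFC : IsFCGroup G) (x : G) :
    (Subgroup.centralizer {x}).FiniteIndex := by
  have : Finite {h : G | IsConj x h} := hFC x
  have : Finite (G ⧸ Subgroup.centralizer {x}) := by
    refine Finite.of_injective (β := {h : G | IsConj x h})
      (fun q => ⟨q.out * x * q.out⁻¹, isConj_iff.2 ⟨_, rfl⟩⟩) fun q r hqr => ?_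
    rw [← QuotientGroup.out_eq' q, ← QuotientGroup.out_eq' r, QuotientGroup.eq,
      Subgroup.mem_centralizer_singleton_iff]
    have h : q.out * x * q.out⁻¹ = r.out * x * r.out⁻¹ := congrArg Subtype.val hqr
    have h' : x = q.out⁻¹ * (r.out * x * r.out⁻¹) * q.out := by rw [← h]; group
    calc q.out⁻¹ * r.out * x = q.out⁻¹ * (r.out * x * r.out⁻¹) * q.out * (q.out⁻¹ * r.out) := by
          group
      _ = x * (q.out⁻¹ * r.out) := by rw [← h']
  exact Subgroup.finiteIndex_of_finite_quotient

theorem finiteIndex_centralizer_of_finite (hFC : IsFCGroup G) {s : Set G} (hs : s.Finite) :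
    (Subgroup.centralizer s).FiniteIndex := by
  have : Finite s := hs
  have h : (⨅ x : s, Subgroup.centralizer {(x : G)}).FiniteIndex :=
    Subgroup.finiteIndex_iInf fun x => finiteIndex_centralizer_singleton hFC x
  refine Subgroup.finiteIndex_of_le (H := ⨅ x : s, Subgroup.centralizer {(x : G)}) fun g hg => ?_
  rw [Subgroup.mem_centralizer_iff]
  intro x hx
  exact Subgroup.mem_centralizer_iff.1 (Subgroup.mem_iInf.1 hg ⟨x, hx⟩) x rfl

theorem ncard_conj_mulAut (φ : MulAut G) (g : G) :
    {h : G | IsConj (φ g) h}.ncard = {h : G | IsConj g h}.ncard := by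
  rw [← Set.ncard_image_of_injective {h : G | IsConj g h} φ.injective]
  congr 1
  ext h
  simp only [Set.mem_ofPred_eq, Set.mem_image, isConj_iff]
  constructor
  · rintro ⟨c, rfl⟩
    exact ⟨_, ⟨φ.symm c, rfl⟩, by simp⟩
  · rintro ⟨_, ⟨c, rfl⟩, rfl⟩
    exact ⟨φ c, by simp⟩

theorem exists_maximal_ncard_conj (hfin : HasFinitelyManyAutOrbits G) :
    ∃ a : G, ∀ g : G, {h : G | IsConj g h}.ncard ≤ {h : G | IsConj a h}.ncard := by
  have : Finite (Quotient (MulAction.orbitRel (MulAut G) G)) := hfin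
  have : Nonempty (Quotient (MulAction.orbitRel (MulAut G) G)) := ⟨Quotient.mk _ 1⟩
  obtain ⟨q, hq⟩ := Finite.exists_max
    fun q : Quotient (MulAction.orbitRel (MulAut G) G) => {h : G | IsConj q.out h}.ncard
  refine ⟨q.out, fun g => ?_⟩
  obtain ⟨φ, hφ⟩ := Quotient.mk_out (s := MulAction.orbitRel (MulAut G) G) g
  have h := hq (Quotient.mk _ g)
  rw [← hφ] at h
  exact (ncard_conj_mulAut φ g).symm.trans_le h

/-- Neumann: an FC-group whose conjugacy classes have bounded size has finitely many
commutators. -/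
theorem finite_commutatorSet_of_maximal_ncard_conj (hFC : IsFCGroup G) (a : G)
    (ha : ∀ g : G, {h : G | IsConj g h}.ncard ≤ {h : G | IsConj a h}.ncard) :
    (commutatorSet G).Finite := by
  set K := {h : G | IsConj a h}
  have hx : ∀ b : G, ∃ x : G, b ∈ K → x * a * x⁻¹ = b := fun b => by
    by_cases hb : b ∈ K
    · obtain ⟨x, hx⟩ := isConj_iff.1 hb
      exact ⟨x, fun _ => hx⟩
    · exact ⟨1, fun h => absurd h hb⟩
  choose x hx using hx
  set C := Subgroup.centralizer (x '' K)
  have : C.FiniteIndex := finiteIndex_centralizer_of_finite hFC ((hFC a).image x)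
  have key : ∀ u ∈ C, ∀ y : G, ∃ b ∈ K, ∃ c ∈ K, u⁻¹ * (y * u * y⁻¹) = b * c⁻¹ := by
    intro u hu y
    have hsub : (u * ·) '' K ⊆ {h : G | IsConj (u * a) h} := by
      rintro _ ⟨b, hb, rfl⟩
      refine isConj_iff.2 ⟨x b, ?_⟩
      have hc := Subgroup.mem_centralizer_iff.1 hu (x b) ⟨b, hb, rfl⟩
      calc x b * (u * a) * (x b)⁻¹ = (x b * u) * a * (x b)⁻¹ := by group
        _ = u * (x b * a * (x b)⁻¹) := by rw [hc]; group
        _ = u * b := by rw [hx b hb]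
    have heq := Set.eq_of_subset_of_ncard_le hsub
      (by rw [Set.ncard_image_of_injective _ (mul_right_injective u)]; exact ha _) (hFC _)
    have hy : y * (u * a) * y⁻¹ ∈ {h : G | IsConj (u * a) h} := isConj_iff.2 ⟨y, rfl⟩
    rw [← heq] at hy
    obtain ⟨b, hb, hby⟩ := hy
    refine ⟨b, hb, y * a * y⁻¹, isConj_iff.2 ⟨y, rfl⟩, ?_⟩
    have : b = u⁻¹ * (y * (u * a) * y⁻¹) := by rw [← hby]; group
    rw [this]
    group
  refine Set.Finite.subset (Set.finite_iUnion fun q : G ⧸ C =>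
    (((hFC a).mul (hFC a).inv).prod (hFC q.out⁻¹)).image
      fun p : G × G => q.out * p.1 * q.out⁻¹ * q.out * p.2) ?_
  rintro _ ⟨g, y, rfl⟩
  obtain ⟨⟨u, hu⟩, hgu⟩ := QuotientGroup.mk_out_eq_mul C g
  set t := (Quotient.out (g : G ⧸ C)) with ht
  have hg : g = t * u⁻¹ := by simp only at hgu; rw [hgu]; group
  obtain ⟨b, hb, c, hc, hbc⟩ := key u hu y
  refine Set.mem_iUnion.2 ⟨(g : G ⧸ C), (b * c⁻¹, y * t⁻¹ * y⁻¹),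
    ⟨Set.mul_mem_mul hb (Set.inv_mem_inv.2 hc), isConj_iff.2 ⟨y, rfl⟩⟩, ?_⟩
  simp only [← hbc, ← ht]
  rw [hg, commutatorElement_def]
  group

theorem finite_commutator (hFC : IsFCGroup G) (hfin : HasFinitelyManyAutOrbits G) :
    Finite (commutator G) := by
  obtain ⟨a, ha⟩ := exists_maximal_ncard_conj hfin
  have : Finite (commutatorSet G) := finite_commutatorSet_of_maximal_ncard_conj hFC a ha
  infer_instance

end FCGroup

section FiniteGroup

theorem mulAut_apply_mem_sylow_center {H : Type*} [Group H] {p : ℕ} [Fact p.Prime] (φ : MulAut H) {x : H}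
    (hx : ∃ P : Sylow p H, x ∈ P ∧ x ∈ Subgroup.centralizer (P : Set H)) :
    ∃ P : Sylow p H, φ x ∈ P ∧ φ x ∈ Subgroup.centralizer (P : Set H) := by
  obtain ⟨P, hP, hc⟩ := hx
  have hmem : ∀ y, y ∈ φ • P ↔ ∃ h ∈ P, φ h = y := fun y => Iff.rfl
  refine ⟨φ • P, (hmem _).2 ⟨x, hP, rfl⟩, ?_⟩
  rw [Subgroup.mem_centralizer_iff]
  intro y hy
  obtain ⟨h, hh, rfl⟩ := (hmem y).1 hy
  rw [← map_mul, ← map_mul, Subgroup.mem_centralizer_iff.1 hc h hh]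

variable {H : Type*} [Group H] [Finite H]

theorem isSolvable_of_isPGroup {p : ℕ} [Fact p.Prime] (h : IsPGroup p H) : Group.IsSolvable H := by
  have := h.isNilpotent
  infer_instance

theorem isPGroup_of_forall_prime_dvd {p : ℕ} (h : ∀ r : ℕ, r.Prime → r ∣ Nat.card H → r = p) :
    IsPGroup p H :=
  IsPGroup.of_card (Nat.eq_prime_pow_of_unique_prime_dvd Nat.card_pos.ne' fun hr hd => h _ hr hd)

/-- If `P` is a Sylow subgroup central in its normalizer and only one further prime divides the
order of the group, then the group is solvable. -/
theorem isSolvable_of_normalizer_le_centralizer {p q : ℕ} [Fact p.Prime] [Fact q.Prime]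
    (hpq : ∀ r : ℕ, r.Prime → r ∣ Nat.card H → r = p ∨ r = q) (P : Sylow p H)
    (hP : Subgroup.normalizer (P : Set H) ≤ Subgroup.centralizer (P : Set H)) :
    Group.IsSolvable H := by
  have hcompl := MonoidHom.ker_transferSylow_isComplement' P hP
  set K := (MonoidHom.transferSylow P hP).ker
  rw [Group.isSolvable_iff_subgroup_quotient K]
  constructor
  · refine isSolvable_of_isPGroup (p := q) (isPGroup_of_forall_prime_dvd fun r hr hd => ?_)
    refine (hpq r hr (hd.trans K.card_subgroup_dvd_card)).resolve_left ?_
    rintro rfl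
    exact MonoidHom.not_dvd_card_ker_transferSylow P hP hd
  · refine isSolvable_of_isPGroup (p := p) ?_
    obtain ⟨n, hn⟩ := IsPGroup.iff_card.1 P.isPGroup'
    refine IsPGroup.of_card (n := n) ?_
    rw [← hn, ← Subgroup.index_eq_card, hcompl.symm.index_eq_card]

/-- If no Sylow `p`-subgroup is central in its normalizer, then the nontrivial elements that are
central in some Sylow `p`-subgroup fill less than half of the group. -/
theorem two_mul_ncard_sylow_central_add_two_le {p : ℕ} [Fact p.Prime]
    (hP : ∀ P : Sylow p H,
      ¬ Subgroup.normalizer (P : Set H) ≤ Subgroup.centralizer (P : Set H)) :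
    2 * {h : H | h ≠ 1 ∧ ∃ P : Sylow p H, h ∈ P ∧ h ∈ Subgroup.centralizer (P : Set H)}.ncard + 2
      ≤ Nat.card H := by
  have := Fintype.ofFinite (Sylow p H)
  let Z : Sylow p H → Subgroup H := fun P => P ⊓ Subgroup.centralizer (P : Set H)
  have hZ : ∀ P : Sylow p H, 2 * Nat.card (Z P) * Nat.card (Sylow p H) ≤ Nat.card H := by
    intro P
    have hle : Z P ≤ Subgroup.normalizer (P : Set H) :=
      inf_le_left.trans Subgroup.le_normalizer
    have hne : (Z P).subgroupOf (Subgroup.normalizer (P : Set H)) ≠ ⊤ := fun h =>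
      hP P ((Subgroup.subgroupOf_eq_top.1 h).trans inf_le_right)
    have h1 := Subgroup.one_lt_index_of_ne_top hne
    have h2 := ((Z P).subgroupOf (Subgroup.normalizer (P : Set H))).card_mul_index
    rw [Nat.card_congr (Subgroup.subgroupOfEquivOfLe hle).toEquiv] at h2
    rw [P.card_eq_index_normalizer,
      ← (Subgroup.normalizer (P : Set H)).card_mul_index, ← h2]
    refine Nat.mul_le_mul_right _ ?_
    rw [mul_comm]
    exact Nat.mul_le_mul_left _ h1
  have hcard : 0 < Nat.card (Sylow p H) := Nat.card_pos
  have hsub : {h : H | h ≠ 1 ∧ ∃ P : Sylow p H, h ∈ P ∧ h ∈ Subgroup.centralizer (P : Set H)} ⊆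
      ⋃ P : Sylow p H, ((Z P : Set H) \ {1}) := by
    rintro h ⟨h1, P, hP1, hP2⟩
    exact Set.mem_iUnion.2 ⟨P, ⟨hP1, hP2⟩, h1⟩
  have hdiff : ∀ P : Sylow p H, ((Z P : Set H) \ {1}).ncard + 1 = Nat.card (Z P) := fun P =>
    Set.ncard_sdiff_singleton_add_one (Z P).one_mem
  have hsum : {h : H | h ≠ 1 ∧ ∃ P : Sylow p H, h ∈ P ∧ h ∈ Subgroup.centralizer (P : Set H)}.ncard
      ≤ ∑ P : Sylow p H, ((Z P : Set H) \ {1}).ncard :=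
    (Set.ncard_le_ncard hsub).trans (Set.ncard_iUnion_le_of_fintype _)
  have hmul : Nat.card (Sylow p H) *
      (2 * ∑ P : Sylow p H, ((Z P : Set H) \ {1}).ncard + 2 * Nat.card (Sylow p H)) ≤
      Nat.card (Sylow p H) * Nat.card H := by
    have e : ∑ P : Sylow p H, ((Z P : Set H) \ {1}).ncard + Nat.card (Sylow p H) =
        ∑ P : Sylow p H, Nat.card (Z P) := by
      rw [Finset.sum_congr rfl fun P _ => (hdiff P).symm, Finset.sum_add_distrib]
      simp [Nat.card_eq_fintype_card]
    rw [← mul_add, e, Finset.mul_sum, Finset.mul_sum]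
    refine (Finset.sum_le_card_nsmul Finset.univ _ (Nat.card H) fun P _ => ?_).trans_eq ?_
    · rw [mul_comm]
      exact hZ P
    · simp [Nat.card_eq_fintype_card]
  have := Nat.le_of_mul_le_mul_left hmul hcard
  omega

theorem exists_orderOf_eq_mem_sylow_center {p : ℕ} [Fact p.Prime] (hp : p ∣ Nat.card H) :
    ∃ x : H, orderOf x = p ∧
      ∃ P : Sylow p H, x ∈ P ∧ x ∈ Subgroup.centralizer (P : Set H) := by
  obtain ⟨P⟩ : Nonempty (Sylow p H) := inferInstance
  have : Nontrivial P := (Subgroup.nontrivial_iff_ne_bot _).2 (P.ne_bot_of_dvd_card hp)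
  have := P.isPGroup'.center_nontrivial
  have hd := (P.isPGroup'.to_subgroup (Subgroup.center P)).card_eq_or_dvd.resolve_left
    Finite.one_lt_card.ne'
  obtain ⟨z, hz⟩ := exists_prime_orderOf_dvd_card' p hd
  refine ⟨z, by rw [Subgroup.orderOf_coe, Subgroup.orderOf_coe, hz], P, z.1.2, ?_⟩
  rw [Subgroup.mem_centralizer_iff]
  intro h hh
  exact congrArg Subtype.val (Subgroup.mem_center_iff.1 z.2 ⟨h, hh⟩)

/-- Laffey–MacHale: a finite group with at most three automorphism orbits is solvable. -/
theorem isSolvable_of_omegaOrbits_le_three (h3 : omegaOrbits H ≤ 3) : Group.IsSolvable H := by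
  by_cases h1 : Nat.card H = 1
  · have := (Nat.card_eq_one_iff_unique.1 h1).1
    infer_instance
  obtain ⟨p, hp, hpd⟩ := Nat.exists_prime_and_dvd h1
  have : Fact p.Prime := ⟨hp⟩
  by_cases hq : ∀ r : ℕ, r.Prime → r ∣ Nat.card H → r = p
  · exact isSolvable_of_isPGroup (isPGroup_of_forall_prime_dvd hq)
  push Not at hq
  obtain ⟨q, hq, hqd, hqp⟩ := hq
  have : Fact q.Prime := ⟨hq⟩
  obtain ⟨x, hxo, hx⟩ := exists_orderOf_eq_mem_sylow_center hpd
  obtain ⟨y, hyo, hy⟩ := exists_orderOf_eq_mem_sylow_center hqd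
  have hcover : ∀ h : H, h ≠ 1 → (∃ φ : MulAut H, φ x = h) ∨ ∃ φ : MulAut H, φ y = h := by
    intro h hh
    by_contra! hcon
    have hxy : ∀ φ : MulAut H, φ x ≠ y := fun φ hφ => hqp <| by
      rw [← hxo, ← hyo, ← hφ, MulEquiv.orderOf_eq]
    have hx1 : x ≠ 1 := fun h => hp.ne_one (by rw [← hxo, h, orderOf_one])
    have hy1 : y ≠ 1 := fun h => hq.ne_one (by rw [← hyo, h, orderOf_one])
    have hsymm : ∀ {a b : H}, (∀ φ : MulAut H, φ a ≠ b) → ∀ φ : MulAut H, φ b ≠ a :=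
      fun hab φ hφ => hab φ.symm (by rw [← hφ]; simp)
    have h4 := card_le_omegaOrbits (G := H) (inferInstanceAs (Finite (Quotient (MulAction.orbitRel (MulAut H) H))))
      ![1, x, y, h] fun i j φ hφ => by
        fin_cases i <;> fin_cases j <;>
          first
          | rfl
          | exact absurd hφ (by simpa [eq_comm] using ‹_ ≠ (1 : H)›)
          | exact absurd hφ (by simp; assumption)
          | exact absurd hφ (hxy φ)
          | exact absurd hφ (hsymm hxy φ)
          | exact absurd hφ (hcon.1 φ)
          | exact absurd hφ (hcon.2 φ)
          | exact absurd hφ (hsymm hcon.1 φ)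
          | exact absurd hφ (hsymm hcon.2 φ)
    rw [Nat.card_fin] at h4
    omega
  have hpq : ∀ r : ℕ, r.Prime → r ∣ Nat.card H → r = p ∨ r = q := by
    intro r hr hrd
    have : Fact r.Prime := ⟨hr⟩
    obtain ⟨z, hz⟩ := exists_prime_orderOf_dvd_card' r hrd
    have hz1 : z ≠ 1 := fun h => hr.ne_one (by rw [← hz, h, orderOf_one])
    rw [← hz, ← hxo, ← hyo]
    refine (hcover z hz1).imp ?_ ?_ <;> rintro ⟨φ, rfl⟩ <;> exact MulEquiv.orderOf_eq φ _
  by_contra hsol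
  have hA := two_mul_ncard_sylow_central_add_two_le (p := p) fun P hP =>
    hsol (isSolvable_of_normalizer_le_centralizer hpq P hP)
  have hB := two_mul_ncard_sylow_central_add_two_le (p := q) fun P hP =>
    hsol (isSolvable_of_normalizer_le_centralizer (fun r hr hd => (hpq r hr hd).symm) P hP)
  set A := {h : H | h ≠ 1 ∧ ∃ P : Sylow p H, h ∈ P ∧ h ∈ Subgroup.centralizer (P : Set H)}
  set B := {h : H | h ≠ 1 ∧ ∃ P : Sylow q H, h ∈ P ∧ h ∈ Subgroup.centralizer (P : Set H)}
  have huniv : (Set.univ : Set H) ⊆ insert 1 (A ∪ B) := by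
    intro h _
    by_cases hh : h = 1
    · exact Or.inl hh
    · refine Or.inr ((hcover h hh).imp ?_ ?_) <;> rintro ⟨φ, rfl⟩
      · exact ⟨hh, mulAut_apply_mem_sylow_center φ hx⟩
      · exact ⟨hh, mulAut_apply_mem_sylow_center φ hy⟩
  have hcard := Set.ncard_le_ncard huniv
  rw [Set.ncard_univ] at hcard
  have := Set.ncard_insert_le 1 (A ∪ B)
  have := Set.ncard_union_le A B
  omega

end FiniteGroup

section ProductBound

variable {G : Type*} [Group G]

/-- Multiplying representatives of the automorphism orbits of `N ⧸ Z(N)` by an element centralizing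
the characteristic subgroup `N` but lying outside it gives new automorphism orbits. -/
theorem omegaOrbits_quotient_center_mul_two_le (hfin : HasFinitelyManyAutOrbits G)
    (N : Subgroup G) [N.Characteristic] {c : G} (hc : c ∈ Subgroup.centralizer (N : Set G))
    (hcN : c ∉ N) : omegaOrbits (N ⧸ Subgroup.center N) * 2 ≤ omegaOrbits G := by
  let ι := Quotient (MulAction.orbitRel (MulAut (N ⧸ Subgroup.center N)) (N ⧸ Subgroup.center N))
  let n : ι → N := fun i => i.out.out
  have hφN : ∀ (φ : MulAut G) {g : G}, g ∈ N → φ g ∈ N := fun φ g hg =>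
    Subgroup.characteristic_iff_le_comap.1 inferInstance φ hg
  have hcomm : ∀ m ∈ N, m * c = c * m := fun m hm => Subgroup.mem_centralizer_iff.1 hc m hm
  have key : ∀ i j (φ : MulAut G),
      (∀ m ∈ N, m * ((n j : G)⁻¹ * φ (n i)) = ((n j : G)⁻¹ * φ (n i)) * m) → i = j := by
    intro i j φ h
    let ψ := MulAut.characteristic N φ
    let χ : MulAut (N ⧸ Subgroup.center N) := QuotientGroup.congr _ _ ψ
      (Subgroup.characteristic_iff_map_eq.1 inferInstance ψ)
    have hmem : (n j)⁻¹ * ψ (n i) ∈ Subgroup.center N :=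
      Subgroup.mem_center_iff.2 fun m => Subtype.ext (h m m.2)
    have hχ : χ i.out = j.out := by
      rw [← QuotientGroup.out_eq' i.out, ← QuotientGroup.out_eq' j.out]
      exact (QuotientGroup.eq.2 hmem).symm
    rw [← Quotient.out_eq i, ← Quotient.out_eq j]
    exact (Quotient.sound (s := MulAction.orbitRel (MulAut (N ⧸ Subgroup.center N)) _)
      ⟨χ, hχ⟩).symm
  have := card_le_omegaOrbits hfin
    (fun a : ι × Bool => (n a.1 : G) * if a.2 then c else 1) ?_
  · rwa [Nat.card_prod, Nat.card_eq_fintype_card (α := Bool), Fintype.card_bool] at this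
  rintro ⟨i, a⟩ ⟨j, b⟩ φ h
  have hinv : ∀ {g : G}, φ g ∈ N → g ∈ N := fun {g} hg => by simpa using hφN φ.symm hg
  have hi := hφN φ (n i).2
  have hj := (n j).2
  cases a <;> cases b <;> simp only [if_true, if_false, Bool.false_eq_true, mul_one, map_mul] at h
  · rw [key i j φ (by simp [h])]
  · exact absurd ((N.mul_mem_cancel_left hj).1 (h ▸ hi)) hcN
  · exact absurd (hinv ((N.mul_mem_cancel_left hi).1 (h ▸ hj))) hcN
  · rw [key i j φ]
    intro m hm
    have e : (n j : G)⁻¹ * φ (n i) = c * (φ c)⁻¹ := by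
      rw [inv_mul_eq_iff_eq_mul, ← mul_assoc, ← h]; group
    have hφc : m * φ c = φ c * m := by
      have := congrArg φ (hcomm (φ.symm m) (hφN φ.symm hm))
      simpa using this
    rw [e, ← mul_assoc, hcomm m hm, mul_assoc, mul_assoc]
    congr 1
    rw [mul_inv_eq_iff_eq_mul, mul_assoc, hφc, inv_mul_cancel_left]

end ProductBound

theorem stmt17 (G : Type*) [Group G] [Infinite G] (hFC : IsFCGroup G)
    (hfin : HasFinitelyManyAutOrbits G) (h7 : omegaOrbits G ≤ 7) :
    IsSolvable G := by
  have hN : Finite (commutator G) := finite_commutator hFC hfin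
  have hC : (Subgroup.centralizer (commutator G : Set G)).FiniteIndex :=
    finiteIndex_centralizer_of_finite hFC hN
  obtain ⟨c, hc, hcN⟩ : ∃ c ∈ Subgroup.centralizer (commutator G : Set G), c ∉ commutator G := by
    by_contra! h
    have : Finite (Subgroup.centralizer (commutator G : Set G)) :=
      Finite.of_injective _ (Subgroup.inclusion_injective h)
    exact not_finite_iff_infinite.2 ‹_›
      ((Subgroup.finite_iff_finite_and_finiteIndex _).2 ⟨this, hC⟩)
  have hbound := omegaOrbits_quotient_center_mul_two_le hfin (commutator G) hc hcN
  have hquot : Group.IsSolvable (commutator G ⧸ Subgroup.center (commutator G)) :=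
    isSolvable_of_omegaOrbits_le_three (by omega)
  have hcenter : Group.IsSolvable (Subgroup.center (commutator G)) :=
    Group.isSolvable_of_comm fun a b => Subtype.ext (Subgroup.mem_center_iff.1 b.2 a)
  have hcomm : Group.IsSolvable (commutator G) :=
    (Group.isSolvable_iff_subgroup_quotient _).2 ⟨hcenter, hquot⟩
  have hab : Group.IsSolvable (G ⧸ commutator G) :=
    inferInstanceAs (Group.IsSolvable (Abelianization G))
  exact (Group.isSolvable_iff_subgroup_quotient (commutator G)).2 ⟨hcomm, hab⟩
end
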